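/- Let q be a prime power, m a positive integer, F = 𝔽_{q^m}, and let K be an algebraic closure of F. Let n ≥ 1 and f_0, …, f_n ∈ F with f_0 ≠ 0 and f_n ≠ 0, and let P(y) = ∑_{i=0}^{n} f_i y^{⟦i⟧} ∈ F[y]. Then P has no repeated roots in K; in particular P has exactly ⟦n⟧ = (q^n − 1)/(q − 1) distinct roots in K, each of multiplicity 1. -/

import Mathlib

open Polynomial

open scoped Classical

/-- `⟦i⟧ = ∑_{j=0}^{i-1} q^j`. -/
def qbrack (q i : ℕ) : ℕ := ∑ j ∈ Finset.range i, q ^ j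

theorem qbrack_succ (q i : ℕ) : qbrack q (i + 1) = q * qbrack q i + 1 := by
  simp [qbrack, Finset.sum_range_succ', Finset.mul_sum, pow_succ']

theorem qbrack_strictMono {q : ℕ} (hq : 0 < q) : StrictMono (qbrack q) :=
  strictMono_nat_of_lt_succ fun i => by
    simp only [qbrack, Finset.sum_range_succ]
    have := pow_pos hq i
    omega

theorem natDegree_sum_C_mul_X_pow_of_strictMono {R : Type*} [Semiring R] {e : ℕ → ℕ}
    (he : StrictMono e) (n : ℕ) (f : ℕ → R) (hfn : f n ≠ 0) :
    (∑ i ∈ Finset.range (n + 1), C (f i) * X ^ e i).natDegree = e n := by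
  refine natDegree_eq_of_le_of_coeff_ne_zero ?_ ?_
  · refine natDegree_sum_le_of_forall_le _ _ fun i hi => ?_
    exact (natDegree_C_mul_X_pow_le _ _).trans
      (he.monotone (Nat.lt_succ_iff.mp (Finset.mem_range.mp hi)))
  · simpa [finsetSum_coeff, coeff_C_mul, coeff_X_pow, he.injective.eq_iff] using hfn

theorem X_mul_derivative_sum_C_mul_X_pow_qbrack {R : Type*} [CommRing R] {q : ℕ}
    (hq : (q : R) = 0) (n : ℕ) (f : ℕ → R) :
    X * derivative (∑ i ∈ Finset.range (n + 1), C (f i) * X ^ qbrack q i) =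
      (∑ i ∈ Finset.range (n + 1), C (f i) * X ^ qbrack q i) - C (f 0) := by
  have h0 : qbrack q 0 = 0 := by simp [qbrack]
  rw [Finset.sum_range_succ', h0, pow_zero, mul_one, add_sub_cancel_right, derivative_add,
    derivative_C, add_zero, derivative_sum, Finset.mul_sum]
  refine Finset.sum_congr rfl fun i _ => ?_
  have h1 : ((qbrack q (i + 1) : ℕ) : R) = 1 := by simp [qbrack_succ, hq]
  rw [derivative_C_mul_X_pow, h1, mul_one, qbrack_succ, Nat.add_sub_cancel, pow_succ]
  ring

theorem separable_sum_C_mul_X_pow_qbrack {F : Type*} [Field F] {q : ℕ} (hq : (q : F) = 0)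
    (n : ℕ) (f : ℕ → F) (hf0 : f 0 ≠ 0) :
    (∑ i ∈ Finset.range (n + 1), C (f i) * X ^ qbrack q i).Separable := by
  refine ⟨C (f 0)⁻¹, -(C (f 0)⁻¹ * X), ?_⟩
  have h := X_mul_derivative_sum_C_mul_X_pow_qbrack hq n f
  have hC : C (f 0)⁻¹ * C (f 0) = 1 := by rw [← C_mul, inv_mul_cancel₀ hf0, C_1]
  linear_combination -C (f 0)⁻¹ * h + hC

/-- If `f_0 ≠ 0` and `f_n ≠ 0`, the right evaluation polynomial
`P(y) = ∑_{i=0}^n f_i y^⟦i⟧` over `F = 𝔽_{q^m}` has no repeated roots in an algebraic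
closure `K`: it has exactly `⟦n⟧ = (q^n - 1)/(q - 1)` distinct roots in `K`, each of
multiplicity `1`. -/
theorem eval_poly_separable_roots (q m : ℕ) (hq : IsPrimePow q) (hm : 0 < m)
    (F : Type*) [Field F] [Fintype F] (hF : Fintype.card F = q ^ m)
    (K : Type*) [Field K] [Algebra F K] [IsAlgClosure F K]
    (n : ℕ) (hn : 1 ≤ n) (f : ℕ → F) (hf0 : f 0 ≠ 0) (hfn : f n ≠ 0)
    (P : F[X]) (hP : P = ∑ i ∈ Finset.range (n + 1), C (f i) * X ^ qbrack q i) :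
    (P.map (algebraMap F K)).roots.Nodup ∧
    (P.map (algebraMap F K)).roots.toFinset.card = qbrack q n ∧
    (∀ a : K, (P.map (algebraMap F K)).eval a = 0 →
      (P.map (algebraMap F K)).rootMultiplicity a = 1) := by
  have hq0 : (q : F) = 0 := by
    have h : ((Fintype.card F : ℕ) : F) = 0 := FiniteField.cast_card_eq_zero F
    rw [hF, Nat.cast_pow] at h
    exact eq_zero_of_pow_eq_zero h
  have hsep : (P.map (algebraMap F K)).Separable :=
    (hP ▸ separable_sum_C_mul_X_pow_qbrack hq0 n f hf0 : P.Separable).map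
  have hnodup := nodup_roots hsep
  have hdeg : P.natDegree = qbrack q n :=
    hP ▸ natDegree_sum_C_mul_X_pow_of_strictMono (qbrack_strictMono hq.pos) n f hfn
  have : IsAlgClosed K := IsAlgClosure.isAlgClosed F
  refine ⟨hnodup, ?_, fun a ha => ?_⟩
  · rw [Multiset.toFinset_card_of_nodup hnodup,
      ← (IsAlgClosed.splits (P.map (algebraMap F K))).natDegree_eq_card_roots,
      natDegree_map, hdeg]
  · rw [← count_roots]
    exact Multiset.count_eq_one_of_mem hnodup ((mem_roots hsep.ne_zero).mpr ha)
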